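/- Assume (A3) and (A6). Then Luckock's equation has exactly one solution (f₋, f₊), and it is given explicitly by f₊(x)/λ₊(x) = 1/λ₊(I₋) + κ_L ∫_{I₋}^x (1/λ₋) d(1/λ₊) and f₋(x)/λ₋(x) = 1/λ₋(I₊) − κ_L ∫_x^{I₊} (1/λ₊) d(1/λ₋) for all x ∈ Ī, where κ_L := Γ⁻¹(1/λ₋(I₊) + 1/λ₊(I₋)). -/

import Mathlib

open MeasureTheory Set
open scoped ENNReal

noncomputable section

/-- The right limit of `f` at `x`, with the convention `f(b+) := f b` at the
right endpoint `b`. -/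
def rLim (b : ℝ) (f : ℝ → ℝ) (x : ℝ) : ℝ :=
  if x < b then Function.rightLim f x else f b

/-- `ν` is the Lebesgue-Stieltjes signed measure `df` of `f` on the interval `[a,b]`,
with the conventions `f(a−) := f a` and `f(b+) := f b`. -/
def IsLS (a b : ℝ) (f : ℝ → ℝ) (ν : MeasureTheory.SignedMeasure ℝ) : Prop :=
  (∀ s : Set ℝ, MeasurableSet s → s ∩ Set.Icc a b = ∅ → ν s = 0) ∧
  (∀ x y : ℝ, a ≤ x → x ≤ y → y ≤ b → ν (Set.Ioc x y) = rLim b f y - rLim b f x) ∧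
  ν {a} = rLim b f a - f a

/-- The integral `∫_s g dν` of `g` over `s` against the signed measure `ν`. -/
def sInt (ν : MeasureTheory.SignedMeasure ℝ) (g : ℝ → ℝ) (s : Set ℝ) : ℝ :=
  (∫ x in s, g x ∂ν.toJordanDecomposition.posPart) -
    ∫ x in s, g x ∂ν.toJordanDecomposition.negPart

/-- Assumption (A3): `lm` (demand) is continuous and nonincreasing, `lp` (supply) is
continuous and nondecreasing on `[a,b]`; both are nonnegative. -/
def A3 (a b : ℝ) (lm lp : ℝ → ℝ) : Prop :=
  ContinuousOn lm (Set.Icc a b) ∧ ContinuousOn lp (Set.Icc a b) ∧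
  AntitoneOn lm (Set.Icc a b) ∧ MonotoneOn lp (Set.Icc a b) ∧
  (∀ x ∈ Set.Icc a b, 0 ≤ lm x) ∧ (∀ x ∈ Set.Icc a b, 0 ≤ lp x)

/-- Assumption (A6): the rates of market orders are positive. -/
def A6 (a b : ℝ) (lm lp : ℝ → ℝ) : Prop := 0 < lp a ∧ 0 < lm b

/-- `(fm, fp)` is a solution of Luckock's equation on `[a,b]` for demand/supply `lm, lp`:
both are continuous of bounded variation, `fm dlp + lm dfp = 0` and `fp dlm + lp dfm = 0`
as signed measures on `[a,b]`, and `fm b = 1 = fp a`. -/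
def LuckockSol (a b : ℝ) (lm lp fm fp : ℝ → ℝ) : Prop :=
  ContinuousOn fm (Set.Icc a b) ∧ ContinuousOn fp (Set.Icc a b) ∧
  BoundedVariationOn fm (Set.Icc a b) ∧ BoundedVariationOn fp (Set.Icc a b) ∧
  fm b = 1 ∧ fp a = 1 ∧
  ∀ νlm νlp νfm νfp : MeasureTheory.SignedMeasure ℝ,
    IsLS a b lm νlm → IsLS a b lp νlp → IsLS a b fm νfm → IsLS a b fp νfp →
    ∀ s : Set ℝ, MeasurableSet s →
      sInt νlp fm s + sInt νfp lm s = 0 ∧ sInt νlm fp s + sInt νfm lp s = 0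


/-- `R x y = o(T y - T x)` uniformly over the subintervals `[x,y]` of `[a,b]` as `y - x → 0`. -/
def Negl (a b : ℝ) (T : ℝ → ℝ) (R : ℝ → ℝ → ℝ) : Prop :=
  ∀ ε > 0, ∃ δ > 0, ∀ x y, a ≤ x → x ≤ y → y ≤ b → y - x < δ → |R x y| ≤ ε * (T y - T x)

/-- The increments of `f` on `[a,b]` are dominated by those of `T`. -/
def IncrLE (a b : ℝ) (T f : ℝ → ℝ) : Prop :=
  ∃ C > 0, ∀ x y, a ≤ x → x ≤ y → y ≤ b → |f y - f x| ≤ C * (T y - T x)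

section Increments

variable {a b : ℝ} {T f g : ℝ → ℝ} {R S : ℝ → ℝ → ℝ}

lemma Negl.congr (h : Negl a b T R)
    (hRS : ∀ x y, a ≤ x → x ≤ y → y ≤ b → S x y = R x y) : Negl a b T S := by
  intro ε hε
  obtain ⟨δ, hδ, H⟩ := h ε hε
  refine ⟨δ, hδ, fun x y hx hxy hy hd => ?_⟩
  rw [hRS x y hx hxy hy]
  exact H x y hx hxy hy hd

lemma Negl.add (hR : Negl a b T R) (hS : Negl a b T S) :
    Negl a b T (fun x y => R x y + S x y) := by
  intro ε hε
  obtain ⟨δ, hδ, H⟩ := hR (ε / 2) (by positivity)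
  obtain ⟨δ', hδ', H'⟩ := hS (ε / 2) (by positivity)
  refine ⟨min δ δ', lt_min hδ hδ', fun x y hx hxy hy hd => ?_⟩
  have h1 := H x y hx hxy hy (hd.trans_le (min_le_left _ _))
  have h2 := H' x y hx hxy hy (hd.trans_le (min_le_right _ _))
  have h3 := abs_add_le (R x y) (S x y)
  linarith

lemma Negl.mul_left (hR : Negl a b T R) (hf : ContinuousOn f (Icc a b)) :
    Negl a b T (fun x y => f x * R x y) := by
  obtain ⟨C, hC⟩ := isCompact_Icc.exists_bound_of_continuousOn hf
  intro ε hε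
  obtain ⟨δ, hδ, H⟩ := hR (ε / (|C| + 1)) (by positivity)
  refine ⟨δ, hδ, fun x y hx hxy hy hd => ?_⟩
  have h1 := H x y hx hxy hy hd
  have h2 : |f x| ≤ |C| + 1 :=
    (hC x ⟨hx, hxy.trans hy⟩).trans ((le_abs_self C).trans (by linarith))
  rw [abs_mul]
  calc |f x| * |R x y| ≤ (|C| + 1) * (ε / (|C| + 1) * (T y - T x)) := by gcongr
    _ = ε * (T y - T x) := by field_simp

lemma Negl.incr_mul_incr (hf : ContinuousOn f (Icc a b)) (hg : IncrLE a b T g) :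
    Negl a b T (fun x y => (f y - f x) * (g y - g x)) := by
  obtain ⟨C, hC0, hC⟩ := hg
  have huc := isCompact_Icc.uniformContinuousOn_of_continuous hf
  intro ε hε
  obtain ⟨δ, hδ, H⟩ := Metric.uniformContinuousOn_iff.1 huc (ε / C) (by positivity)
  refine ⟨δ, hδ, fun x y hx hxy hy hd => ?_⟩
  have h1 : |f y - f x| ≤ ε / C :=
    (H y ⟨hx.trans hxy, hy⟩ x ⟨hx, hxy.trans hy⟩
      (by rw [Real.dist_eq, abs_of_nonneg (by linarith)]; exact hd)).le
  rw [abs_mul]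
  calc |f y - f x| * |g y - g x| ≤ ε / C * (C * (T y - T x)) := by
        gcongr
        exact hC x y hx hxy hy
    _ = ε * (T y - T x) := by field_simp

lemma incr_nonpos_of_negl (hf : Negl a b T (fun x y => f y - f x - R x y))
    (hR : ∀ x y, a ≤ x → x ≤ y → y ≤ b → R x y ≤ 0) {x y : ℝ}
    (hx : a ≤ x) (hxy : x ≤ y) (hy : y ≤ b) : f y ≤ f x := by
  have key : ∀ ε > 0, f y - f x ≤ ε * (T y - T x) := by
    intro ε hε
    obtain ⟨δ, hδ, H⟩ := hf ε hε
    have ind : ∀ n : ℕ, ∀ u v, a ≤ u → u ≤ v → v ≤ b → v - u ≤ n * (δ / 2) →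
        f v - f u ≤ ε * (T v - T u) := by
      intro n
      induction n with
      | zero =>
        intro u v _ huv _ hd
        have : u = v := by simp at hd; linarith
        simp [this]
      | succ n ih =>
        intro u v hu huv hv hd
        push_cast at hd
        have hz : u ≤ max u (v - δ / 2) := le_max_left _ _
        have hzv : max u (v - δ / 2) ≤ v := max_le huv (by linarith)
        have hzd : v - max u (v - δ / 2) ≤ δ / 2 := by
          linarith [le_max_right u (v - δ / 2)]
        have hn : (0 : ℝ) ≤ n * (δ / 2) := by positivity
        have h1 := ih u (max u (v - δ / 2)) hu hz (hzv.trans hv) (by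
          rcases max_cases u (v - δ / 2) with h | h <;> rw [h.1] <;> linarith)
        have h2 := H (max u (v - δ / 2)) v (hu.trans hz) hzv hv (by linarith)
        have h3 := hR (max u (v - δ / 2)) v (hu.trans hz) hzv hv
        have h4 := le_abs_self (f v - f (max u (v - δ / 2)) - R (max u (v - δ / 2)) v)
        linarith
    obtain ⟨n, hn⟩ := exists_nat_ge ((y - x) / (δ / 2))
    exact ind n x y hx hxy hy ((div_le_iff₀ (by positivity)).1 hn)
  have h0 : Filter.Tendsto (fun ε : ℝ => ε * (T y - T x)) (nhdsWithin 0 (Ioi 0)) (nhds 0) := by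
    have : Filter.Tendsto (fun ε : ℝ => ε * (T y - T x)) (nhds 0) (nhds (0 * (T y - T x))) :=
      (continuous_id.mul continuous_const).tendsto 0
    rw [zero_mul] at this
    exact this.mono_left nhdsWithin_le_nhds
  have := ge_of_tendsto h0 (Filter.eventually_of_mem self_mem_nhdsWithin key)
  linarith

lemma eq_of_negl_incr (hf : Negl a b T (fun x y => f y - f x)) {x y : ℝ}
    (hx : x ∈ Icc a b) (hy : y ∈ Icc a b) : f x = f y := by
  have aux : ∀ x y, a ≤ x → x ≤ y → y ≤ b → f x = f y := by
    intro x y hx hxy hy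
    refine le_antisymm ?_ ?_
    · have hn : Negl a b T (fun x y => (-f) y - (-f) x - 0) := by
        refine (hf.mul_left (f := fun _ => -1) continuousOn_const).congr fun u v _ _ _ => ?_
        simp only [Pi.neg_apply]
        ring
      have := incr_nonpos_of_negl (R := fun _ _ => 0) hn (fun _ _ _ _ _ => le_rfl) hx hxy hy
      simpa using this
    · exact incr_nonpos_of_negl (R := fun _ _ => 0) (by simpa using hf)
        (fun _ _ _ _ _ => le_rfl) hx hxy hy
  rcases le_total x y with h | h
  · exact aux x y hx.1 h hy.2
  · exact (aux y x hy.1 h hx.2).symm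

lemma IncrLE.const_add_mul (c κ : ℝ) (hf : IncrLE a b T f) :
    IncrLE a b T (fun x => c + κ * f x) := by
  obtain ⟨C, hC0, hC⟩ := hf
  refine ⟨(|κ| + 1) * C, by positivity, fun x y hx hxy hy => ?_⟩
  have h1 := hC x y hx hxy hy
  rw [show c + κ * f y - (c + κ * f x) = κ * (f y - f x) by ring, abs_mul]
  calc |κ| * |f y - f x| ≤ (|κ| + 1) * (C * (T y - T x)) := by gcongr; linarith
    _ = (|κ| + 1) * C * (T y - T x) := by ring

lemma MonotoneOn.boundedVariationOn_Icc (hab : a ≤ b) (hT : MonotoneOn T (Icc a b)) :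
    BoundedVariationOn T (Icc a b) := by
  have := hT.eVariationOn_eq (left_mem_Icc.2 hab) (right_mem_Icc.2 hab)
  rw [inter_self] at this
  exact ne_top_of_le_ne_top ENNReal.ofReal_ne_top this.le

lemma IncrLE.boundedVariationOn (hf : IncrLE a b T f) (hT : BoundedVariationOn T (Icc a b)) :
    BoundedVariationOn f (Icc a b) := by
  obtain ⟨C, hC0, hC⟩ := hf
  have hle : eVariationOn f (Icc a b) ≤ ENNReal.ofReal C * eVariationOn T (Icc a b) := by
    refine iSup_le fun p => ?_
    refine le_trans ?_ (mul_le_mul_right (eVariationOn.sum_le (n := p.1) p.2.2.1 p.2.2.2) _)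
    rw [Finset.mul_sum]
    refine Finset.sum_le_sum fun i _ => ?_
    have hm := p.2.2.1 (Nat.le_succ i)
    have h1 := hC _ _ (p.2.2.2 i).1 hm (p.2.2.2 (i + 1)).2
    rw [edist_dist, edist_dist, Real.dist_eq, Real.dist_eq,
      ← ENNReal.ofReal_mul hC0.le]
    exact ENNReal.ofReal_le_ofReal (h1.trans (by gcongr; exact le_abs_self _))
  exact ne_top_of_le_ne_top (ENNReal.mul_ne_top ENNReal.ofReal_ne_top hT) hle

lemma AntitoneOn.boundedVariationOn_Icc (hab : a ≤ b) (hf : AntitoneOn f (Icc a b)) :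
    BoundedVariationOn f (Icc a b) := by
  refine IncrLE.boundedVariationOn (T := fun x => -f x) ⟨1, one_pos, fun x y hx hxy hy => ?_⟩
    (MonotoneOn.boundedVariationOn_Icc hab hf.neg)
  have := hf ⟨hx, hxy.trans hy⟩ ⟨hx.trans hxy, hy⟩ hxy
  rw [abs_of_nonpos (by linarith)]
  linarith

end Increments

section SignedMeasures

variable {a b : ℝ} {f g : ℝ → ℝ} {ν : SignedMeasure ℝ} {μ : Measure ℝ}

lemma rLim_eq_of_continuousOn (hf : ContinuousOn f (Icc a b)) {x : ℝ} (hx : x ∈ Icc a b) :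
    rLim b f x = f x := by
  unfold rLim
  split_ifs with h
  · have h1 : ContinuousWithinAt f (Icc x b) x := (hf x hx).mono (Icc_subset_Icc_left hx.1)
    exact (h1.mono_of_mem_nhdsWithin (Icc_mem_nhdsGE h)).rightLim_eq
  · rw [le_antisymm hx.2 (not_lt.1 h)]

lemma IsLS.apply_Ioc (hν : IsLS a b f ν) (hf : ContinuousOn f (Icc a b)) {x y : ℝ}
    (hx : a ≤ x) (hxy : x ≤ y) (hy : y ≤ b) : ν (Ioc x y) = f y - f x := by
  rw [hν.2.1 x y hx hxy hy, rLim_eq_of_continuousOn hf ⟨hx, hxy.trans hy⟩,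
    rLim_eq_of_continuousOn hf ⟨hx.trans hxy, hy⟩]

lemma IsLS.apply_singleton (hν : IsLS a b f ν) (hf : ContinuousOn f (Icc a b)) (x : ℝ) :
    ν {x} = 0 := by
  by_cases hx : x ∈ Icc a b
  swap
  · exact hν.1 _ (measurableSet_singleton x) (by simpa using hx)
  rcases hx.1.eq_or_lt with rfl | hax
  · rw [hν.2.2, rLim_eq_of_continuousOn hf hx, sub_self]
  obtain ⟨u, hu, hux, hlim⟩ := exists_seq_strictMono_tendsto' hax
  have hanti : Antitone fun n => Ioc (u n) x :=
    fun m n hmn => Ioc_subset_Ioc_left (hu.monotone hmn)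
  have hInter : ⋂ n, Ioc (u n) x = {x} := by
    ext t
    simp only [mem_iInter, mem_Ioc, mem_singleton_iff]
    refine ⟨fun h => le_antisymm (h 0).2 (le_of_tendsto' hlim fun n => (h n).1.le), ?_⟩
    rintro rfl n
    exact ⟨(hux n).2, le_rfl⟩
  have h1 := VectorMeasure.tendsto_vectorMeasure_iInter_atTop_nat (v := ν) hanti
    (fun _ => measurableSet_Ioc)
  rw [hInter] at h1
  have h2 : Filter.Tendsto (fun n => ν (Ioc (u n) x)) Filter.atTop (nhds (f x - f x)) := by
    have h3 : ∀ n, ν (Ioc (u n) x) = f x - f (u n) := fun n =>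
      hν.apply_Ioc hf (hux n).1.le (hux n).2.le hx.2
    simp_rw [h3]
    refine tendsto_const_nhds.sub ((hf x hx).tendsto.comp ?_)
    exact tendsto_nhdsWithin_iff.2 ⟨hlim, Filter.Eventually.of_forall fun n =>
      ⟨(hux n).1.le, (hux n).2.le.trans hx.2⟩⟩
  rw [tendsto_nhds_unique h1 h2, sub_self]

lemma totalVariation_eq_zero {s : Set ℝ} (hs : MeasurableSet s)
    (h : ∀ t ⊆ s, MeasurableSet t → ν t = 0) : ν.totalVariation s = 0 := by
  obtain ⟨i, hi, hi₂, hi₃, hp, hn⟩ := ν.toJordanDecomposition_spec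
  rw [SignedMeasure.totalVariation, Measure.add_apply, hp, hn,
    SignedMeasure.toMeasureOfZeroLE_apply _ _ hi hs,
    SignedMeasure.toMeasureOfLEZero_apply _ _ hi.compl hs]
  have h1 := h (i ∩ s) inter_subset_right (hi.inter hs)
  have h2 := h (iᶜ ∩ s) inter_subset_right (hi.compl.inter hs)
  simp only [h1, h2, neg_zero]
  simp

lemma IsLS.totalVariation_compl (hν : IsLS a b f ν) : ν.totalVariation (Icc a b)ᶜ = 0 :=
  totalVariation_eq_zero measurableSet_Icc.compl fun t ht htm => hν.1 t htm
    (disjoint_iff_inter_eq_empty.1 (disjoint_left.2 fun _ hx => ht hx))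

lemma IsLS.nullSingletonClass_totalVariation (hν : IsLS a b f ν) (hf : ContinuousOn f (Icc a b)) :
    NullSingletonClass ν.totalVariation := by
  refine ⟨fun x => totalVariation_eq_zero (measurableSet_singleton x) fun t ht _ => ?_⟩
  rcases subset_singleton_iff_eq.1 ht with rfl | rfl
  · simp
  · exact hν.apply_singleton hf x

lemma exists_isLS (hab : a ≤ b) (hf : ContinuousOn f (Icc a b))
    (hbv : BoundedVariationOn f (Icc a b)) : ∃ ν, IsLS a b f ν := by
  set φ : ℝ → ℝ := fun x => (projIcc a b hab x : ℝ) with hφ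
  have hmem : ∀ x, φ x ∈ Icc a b := fun x => (projIcc a b hab x).2
  have hφx : ∀ x ∈ Icc a b, φ x = x := fun x hx => by simp [hφ, projIcc_of_mem hab hx]
  have hcont : Continuous (f ∘ φ) :=
    hf.comp_continuous (continuous_subtype_val.comp continuous_projIcc) hmem
  have hF : BoundedVariationOn (f ∘ φ) univ :=
    ne_top_of_le_ne_top hbv (eVariationOn.comp_le_of_monotoneOn f φ
      ((Subtype.mono_coe _).comp (monotone_projIcc hab) |>.monotoneOn _) (fun x _ => hmem x))
  have hright : ∀ x, Function.rightLim (f ∘ φ) x = f (φ x) := fun x =>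
    hcont.continuousAt.continuousWithinAt.rightLim_eq
  have hleft : ∀ x, Function.leftLim (f ∘ φ) x = f (φ x) := fun x =>
    hcont.continuousAt.continuousWithinAt.leftLim_eq
  refine ⟨hF.vectorMeasure.restrict (Icc a b), fun s hs hsab => ?_, fun x y hx hxy hy => ?_, ?_⟩
  · rw [VectorMeasure.restrict_apply _ measurableSet_Icc hs, hsab, VectorMeasure.empty]
  · rw [VectorMeasure.restrict_apply _ measurableSet_Icc measurableSet_Ioc,
      inter_eq_left.2 (Ioc_subset_Icc_self.trans (Icc_subset_Icc hx hy)),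
      hF.vectorMeasure_Ioc hxy, hright, hright,
      rLim_eq_of_continuousOn hf ⟨hx, hxy.trans hy⟩,
      rLim_eq_of_continuousOn hf ⟨hx.trans hxy, hy⟩, hφx x ⟨hx, hxy.trans hy⟩,
      hφx y ⟨hx.trans hxy, hy⟩]
  · rw [VectorMeasure.restrict_apply _ measurableSet_Icc (measurableSet_singleton a),
      inter_eq_left.2 (singleton_subset_iff.2 (left_mem_Icc.2 hab)),
      hF.vectorMeasure_singleton, hright, hleft,
      rLim_eq_of_continuousOn hf (left_mem_Icc.2 hab), sub_self, sub_self]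

lemma signedMeasure_eq_zero (hab : a ≤ b)
    (hsupp : ∀ s, MeasurableSet s → s ∩ Icc a b = ∅ → ν s = 0) (ha : ν {a} = 0)
    (hIoc : ∀ x y, a ≤ x → x ≤ y → y ≤ b → ν (Ioc x y) = 0) : ν = 0 := by
  have hIcc : ∀ y, a ≤ y → y ≤ b → ν (Icc a y) = 0 := by
    intro y hy hyb
    rw [← Ioc_union_left hy, VectorMeasure.of_union (by simp) measurableSet_Ioc
      (measurableSet_singleton a), ha, hIoc a y le_rfl hy hyb, add_zero]
  have hinter : ∀ s, MeasurableSet s → ν s = ν (s ∩ Icc a b) := by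
    intro s hs
    rw [← VectorMeasure.of_add_of_sdiff (hs.inter measurableSet_Icc) hs inter_subset_left,
      hsupp (s \ (s ∩ Icc a b)) (hs.diff (hs.inter measurableSet_Icc)) (by ext; simp),
      add_zero]
  refine VectorMeasure.ext_of_generateFrom {S | ∃ l u, l < u ∧ Ioc l u = S} ?_ ?_
    (isPiSystem_Ioc id id) ?_
  · rintro _ ⟨l, u, -, rfl⟩
    rw [hinter _ measurableSet_Ioc, zero_apply]
    by_cases hu : a ≤ u
    swap
    · rw [show Ioc l u ∩ Icc a b = ∅ from ?_, VectorMeasure.empty]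
      ext t
      simp only [mem_inter_iff, mem_Ioc, mem_Icc, mem_empty_iff_false, iff_false]
      intro h
      linarith [h.1.2, h.2.1]
    by_cases hl : a ≤ l
    · by_cases hlu : min l b ≤ min u b
      · rw [show Ioc l u ∩ Icc a b = Ioc (min l b) (min u b) from ?_]
        · exact hIoc _ _ (le_min hl hab) hlu (min_le_right _ _)
        · ext t
          grind
      · rw [show Ioc l u ∩ Icc a b = ∅ from by ext t; grind, VectorMeasure.empty]
    · rw [show Ioc l u ∩ Icc a b = Icc a (min u b) from by ext t; grind]
      exact hIcc _ (le_min hu hab) (min_le_right _ _)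
  · rw [← borel_eq_generateFrom_Ioc ℝ]
    exact BorelSpace.measurable_eq
  · rw [hinter _ MeasurableSet.univ, univ_inter, hIcc b hab le_rfl, zero_apply]

lemma posPart_le_totalVariation : ν.toJordanDecomposition.posPart ≤ ν.totalVariation :=
  Measure.le_add_right le_rfl

lemma negPart_le_totalVariation : ν.toJordanDecomposition.negPart ≤ ν.totalVariation :=
  Measure.le_add_left le_rfl

lemma IsLS.integrable (hν : IsLS a b f ν) (hg : ContinuousOn g (Icc a b)) :
    Integrable g ν.totalVariation := by
  have h : ν.totalVariation.restrict (Icc a b) = ν.totalVariation :=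
    Measure.restrict_eq_self_of_ae_mem (mem_ae_iff.2 hν.totalVariation_compl)
  rw [← h]
  exact hg.integrableOn_compact isCompact_Icc

lemma abs_sInt_sub_le (hg : Integrable g ν.totalVariation) {s : Set ℝ} (hs : MeasurableSet s)
    {c C : ℝ} (h : ∀ t ∈ s, |g t - c| ≤ C) :
    |sInt ν g s - c * ν s| ≤ C * ν.totalVariation.real s := by
  have key : ∀ m : Measure ℝ, IsFiniteMeasure m → m ≤ ν.totalVariation →
      |(∫ x in s, g x ∂m) - c * m.real s| ≤ C * m.real s := by
    intro m _ hm
    have h1 : (∫ x in s, g x ∂m) - c * m.real s = ∫ x in s, (g x - c) ∂m := by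
      rw [integral_sub ((hg.mono_measure hm).integrableOn) (integrable_const c)]
      simp [mul_comm]
    rw [h1, ← Real.norm_eq_abs]
    exact norm_setIntegral_le_of_norm_le_const (measure_lt_top m s) h
  have hp := key _ inferInstance posPart_le_totalVariation
  have hn := key _ inferInstance negPart_le_totalVariation
  rw [ν.apply_eq_posPart_real_sub_negPart_real hs, SignedMeasure.totalVariation,
    measureReal_add_apply, sInt]
  rw [abs_le] at *
  constructor <;> linarith [hp.1, hp.2, hn.1, hn.2]

lemma sInt_union (hg : Integrable g ν.totalVariation) {s t : Set ℝ} (hst : Disjoint s t)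
    (ht : MeasurableSet t) : sInt ν g (s ∪ t) = sInt ν g s + sInt ν g t := by
  have hp := hg.mono_measure posPart_le_totalVariation
  have hn := hg.mono_measure negPart_le_totalVariation
  unfold sInt
  rw [setIntegral_union hst ht hp.integrableOn hp.integrableOn,
    setIntegral_union hst ht hn.integrableOn hn.integrableOn]
  ring

lemma sInt_Ioc_add_Ioc (hg : Integrable g ν.totalVariation) {x y z : ℝ} (hxy : x ≤ y)
    (hyz : y ≤ z) : sInt ν g (Ioc x y) + sInt ν g (Ioc y z) = sInt ν g (Ioc x z) := by
  rw [← Ioc_union_Ioc_eq_Ioc hxy hyz,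
    sInt_union hg (Ioc_disjoint_Ioc_of_le le_rfl) measurableSet_Ioc]

lemma sInt_eq_zero {s : Set ℝ} (h : ν.totalVariation s = 0) : sInt ν g s = 0 := by
  have hp := le_antisymm ((posPart_le_totalVariation s).trans_eq h) zero_le
  have hn := le_antisymm ((negPart_le_totalVariation s).trans_eq h) zero_le
  simp [sInt, Measure.restrict_eq_zero.2, hp, hn]

lemma exists_signedMeasure_eq_sInt (hg : Integrable g ν.totalVariation) :
    ∃ ρ : SignedMeasure ℝ, ∀ s, MeasurableSet s → ρ s = sInt ν g s := by
  have hp := hg.mono_measure posPart_le_totalVariation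
  have hn := hg.mono_measure negPart_le_totalVariation
  refine ⟨ν.toJordanDecomposition.posPart.withDensityᵥ g -
    ν.toJordanDecomposition.negPart.withDensityᵥ g, fun s hs => ?_⟩
  rw [sub_apply, withDensityᵥ_apply hp hs, withDensityᵥ_apply hn hs, sInt]

end SignedMeasures

section Control

variable {a b : ℝ} {f g h p q : ℝ → ℝ} {ν ν₁ ν₂ : SignedMeasure ℝ} {μ : Measure ℝ}
  [IsFiniteMeasure μ]

lemma real_Ioc_sub {x y : ℝ} (hx : a ≤ x) (hxy : x ≤ y) :
    μ.real (Ioc a y) - μ.real (Ioc a x) = μ.real (Ioc x y) := by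
  rw [← Ioc_union_Ioc_eq_Ioc hx hxy,
    measureReal_union (Ioc_disjoint_Ioc_of_le le_rfl) measurableSet_Ioc]
  ring

lemma totalVariation_real_le (hμ : ν.totalVariation ≤ μ) (s : Set ℝ) :
    ν.totalVariation.real s ≤ μ.real s :=
  ENNReal.toReal_mono (measure_ne_top μ s) (hμ s)

lemma boundedVariationOn_real_Ioc (hab : a ≤ b) :
    BoundedVariationOn (fun x => μ.real (Ioc a x)) (Icc a b) :=
  MonotoneOn.boundedVariationOn_Icc hab fun _ _ _ _ hxy =>
    measureReal_mono (Ioc_subset_Ioc_right hxy)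

lemma IsLS.incrLE (hν : IsLS a b f ν) (hf : ContinuousOn f (Icc a b))
    (hμ : ν.totalVariation ≤ μ) : IncrLE a b (fun x => μ.real (Ioc a x)) f := by
  refine ⟨1, one_pos, fun x y hx hxy hy => ?_⟩
  have h1 := abs_sInt_sub_le (ν := ν) (g := fun _ => 0) (integrable_zero _ _ _)
    (measurableSet_Ioc (a := x) (b := y)) (c := 1) (C := 1) (by simp)
  rw [show sInt ν (fun _ => 0) (Ioc x y) = 0 by simp [sInt], zero_sub, abs_neg, one_mul,
    hν.apply_Ioc hf hx hxy hy] at h1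
  rw [real_Ioc_sub hx hxy, one_mul]
  linarith [totalVariation_real_le hμ (Ioc x y)]

lemma IsLS.negl_sInt (hν : IsLS a b f ν) (hf : ContinuousOn f (Icc a b))
    (hμ : ν.totalVariation ≤ μ) (hg : ContinuousOn g (Icc a b)) :
    Negl a b (fun x => μ.real (Ioc a x))
      (fun x y => sInt ν g (Ioc x y) - g x * (f y - f x)) := by
  have huc := isCompact_Icc.uniformContinuousOn_of_continuous hg
  intro ε hε
  obtain ⟨δ, hδ, H⟩ := Metric.uniformContinuousOn_iff.1 huc ε hε
  refine ⟨δ, hδ, fun x y hx hxy hy hd => ?_⟩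
  beta_reduce
  rw [real_Ioc_sub hx hxy, ← hν.apply_Ioc hf hx hxy hy]
  refine (abs_sInt_sub_le (hν.integrable hg) measurableSet_Ioc fun t ht => ?_).trans
    (mul_le_mul_of_nonneg_left (totalVariation_real_le hμ _) hε.le)
  refine (H t ⟨hx.trans ht.1.le, ht.2.trans hy⟩ x ⟨hx, hxy.trans hy⟩ ?_).le
  rw [Real.dist_eq, abs_of_nonneg (by linarith [ht.1])]
  linarith [ht.2]

lemma IsLS.sInt_Ioc_sub (hν : IsLS a b f ν) (hg : ContinuousOn g (Icc a b)) {x y : ℝ}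
    (hx : a ≤ x) (hxy : x ≤ y) :
    sInt ν g (Ioc a y) - sInt ν g (Ioc a x) = sInt ν g (Ioc x y) := by
  rw [← sInt_Ioc_add_Ioc (hν.integrable hg) hx hxy]
  ring

lemma IsLS.incrLE_sInt (hν : IsLS a b f ν) (hμ : ν.totalVariation ≤ μ)
    (hg : ContinuousOn g (Icc a b)) :
    IncrLE a b (fun x => μ.real (Ioc a x)) (fun x => sInt ν g (Ioc a x)) := by
  obtain ⟨C, hC⟩ := isCompact_Icc.exists_bound_of_continuousOn hg
  refine ⟨|C| + 1, by positivity, fun x y hx hxy hy => ?_⟩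
  rw [hν.sInt_Ioc_sub hg hx hxy, real_Ioc_sub hx hxy]
  have h1 := abs_sInt_sub_le (hν.integrable hg) (measurableSet_Ioc (a := x) (b := y))
    (c := 0) (C := |C| + 1) fun t ht => by
      rw [sub_zero]
      exact (hC t ⟨hx.trans ht.1.le, ht.2.trans hy⟩).trans (by linarith [le_abs_self C])
  rw [zero_mul, sub_zero] at h1
  exact h1.trans (mul_le_mul_of_nonneg_left (totalVariation_real_le hμ _) (by positivity))

lemma IsLS.sub_eq_of_negl {u : ℝ → ℝ} {κ : ℝ} (hν : IsLS a b f ν)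
    (hf : ContinuousOn f (Icc a b)) (hμ : ν.totalVariation ≤ μ) (hg : ContinuousOn g (Icc a b))
    (hu : Negl a b (fun x => μ.real (Ioc a x))
      (fun x y => u y - u x - κ * (g x * (f y - f x)))) {x y : ℝ}
    (hx : a ≤ x) (hxy : x ≤ y) (hy : y ≤ b) : u y - u x = κ * sInt ν g (Ioc x y) := by
  have hn : Negl a b (fun x => μ.real (Ioc a x)) (fun x y =>
      (u y - κ * sInt ν g (Ioc a y)) - (u x - κ * sInt ν g (Ioc a x))) := by
    refine (hu.add ((hν.negl_sInt hf hμ hg).mul_left (f := fun _ => -κ)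
      continuousOn_const)).congr fun s t hs hst _ => ?_
    rw [← hν.sInt_Ioc_sub hg hs hst]
    ring
  have := eq_of_negl_incr (f := fun x => u x - κ * sInt ν g (Ioc a x)) hn
    ⟨hx, hxy.trans hy⟩ ⟨hx.trans hxy, hy⟩
  rw [← hν.sInt_Ioc_sub hg hx hxy]
  linarith

lemma IsLS.continuousOn_sInt (hν : IsLS a b f ν) (hf : ContinuousOn f (Icc a b))
    (hg : ContinuousOn g (Icc a b)) : ContinuousOn (fun x => sInt ν g (Ioc a x)) (Icc a b) := by
  have hatoms := hν.nullSingletonClass_totalVariation hf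
  have hi := hν.integrable hg
  have key : ∀ m : Measure ℝ, m ≤ ν.totalVariation →
      ContinuousOn (fun x => ∫ t in Ioc a x, g t ∂m) (Icc a b) := by
    intro m hm
    have : NullSingletonClass m := ⟨fun x => le_antisymm
      ((hm {x}).trans_eq (measure_singleton x)) zero_le⟩
    exact intervalIntegral.continuousOn_primitive (hi.mono_measure hm).integrableOn
  exact (key _ posPart_le_totalVariation).sub (key _ negPart_le_totalVariation)

lemma sInt_add_sInt_eq_zero_iff (hab : a ≤ b) (hν₁ : IsLS a b p ν₁) (hν₂ : IsLS a b q ν₂)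
    (hp : ContinuousOn p (Icc a b)) (hq : ContinuousOn q (Icc a b))
    (hg : ContinuousOn g (Icc a b)) (hh : ContinuousOn h (Icc a b))
    (hμ₁ : ν₁.totalVariation ≤ μ) (hμ₂ : ν₂.totalVariation ≤ μ) :
    (∀ s, MeasurableSet s → sInt ν₁ g s + sInt ν₂ h s = 0) ↔
      Negl a b (fun x => μ.real (Ioc a x))
        (fun x y => g x * (p y - p x) + h x * (q y - q x)) := by
  have h₁ := hν₁.negl_sInt hp hμ₁ hg
  have h₂ := hν₂.negl_sInt hq hμ₂ hh
  constructor
  · intro H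
    refine ((h₁.add h₂).mul_left (f := fun _ => -1) continuousOn_const).congr
      fun x y _ _ _ => ?_
    linear_combination (H (Ioc x y) measurableSet_Ioc)
  · intro H
    obtain ⟨ρ₁, hρ₁⟩ := exists_signedMeasure_eq_sInt (hν₁.integrable hg)
    obtain ⟨ρ₂, hρ₂⟩ := exists_signedMeasure_eq_sInt (hν₂.integrable hh)
    have hρ : ∀ s, MeasurableSet s → (ρ₁ + ρ₂) s = sInt ν₁ g s + sInt ν₂ h s := fun s hs => by
      rw [add_apply, hρ₁ s hs, hρ₂ s hs]
    have hnull : ∀ s, ν₁.totalVariation s = 0 → ν₂.totalVariation s = 0 →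
        sInt ν₁ g s + sInt ν₂ h s = 0 := fun s hs₁ hs₂ => by
      rw [sInt_eq_zero hs₁, sInt_eq_zero hs₂, add_zero]
    have h0 : ρ₁ + ρ₂ = 0 := by
      refine signedMeasure_eq_zero hab (fun s hs hsab => ?_) ?_ fun x y hx hxy hy => ?_
      · rw [hρ s hs]
        have hsub : s ⊆ (Icc a b)ᶜ :=
          (disjoint_iff_inter_eq_empty.2 hsab).subset_compl_right
        exact hnull s (measure_mono_null hsub hν₁.totalVariation_compl)
          (measure_mono_null hsub hν₂.totalVariation_compl)
      · rw [hρ _ (measurableSet_singleton a)]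
        have := hν₁.nullSingletonClass_totalVariation hp
        have := hν₂.nullSingletonClass_totalVariation hq
        exact hnull _ (measure_singleton a) (measure_singleton a)
      · rw [hρ _ measurableSet_Ioc, ← hν₁.sInt_Ioc_sub hg hx hxy,
          ← hν₂.sInt_Ioc_sub hh hx hxy]
        have hn : Negl a b (fun x => μ.real (Ioc a x)) (fun x y =>
            (sInt ν₁ g (Ioc a y) + sInt ν₂ h (Ioc a y)) -
              (sInt ν₁ g (Ioc a x) + sInt ν₂ h (Ioc a x))) := by
          refine ((h₁.add h₂).add H).congr fun u v hu huv _ => ?_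
          rw [← hν₁.sInt_Ioc_sub hg hu huv, ← hν₂.sInt_Ioc_sub hh hu huv]
          ring
        have := eq_of_negl_incr (f := fun x => sInt ν₁ g (Ioc a x) + sInt ν₂ h (Ioc a x)) hn
          ⟨hx, hxy.trans hy⟩ ⟨hx.trans hxy, hy⟩
        linarith
    intro s hs
    rw [← hρ s hs, h0, zero_apply]

end Control

lemma exists_measure_ge (ν₁ ν₂ ν₃ ν₄ ν₅ ν₆ : SignedMeasure ℝ) :
    ∃ μ : Measure ℝ, IsFiniteMeasure μ ∧ ν₁.totalVariation ≤ μ ∧ ν₂.totalVariation ≤ μ ∧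
      ν₃.totalVariation ≤ μ ∧ ν₄.totalVariation ≤ μ ∧ ν₅.totalVariation ≤ μ ∧
      ν₆.totalVariation ≤ μ := by
  let ν : Fin 6 → SignedMeasure ℝ := ![ν₁, ν₂, ν₃, ν₄, ν₅, ν₆]
  have h : ∀ i, (ν i).totalVariation ≤ Measure.sum fun i => (ν i).totalVariation :=
    fun i => Measure.le_sum _ i
  exact ⟨Measure.sum fun i => (ν i).totalVariation, inferInstance, h 0, h 1, h 2, h 3, h 4, h 5⟩

section Luckock

variable {a b κ : ℝ} {T lm lp fm fp P M : ℝ → ℝ}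

lemma negl_conserved (hlm : ContinuousOn lm (Icc a b)) (hlp : ContinuousOn lp (Icc a b))
    (hfm : IncrLE a b T fm) (hfp : IncrLE a b T fp)
    (h₁ : Negl a b T (fun x y => fm x * (lp y - lp x) + lm x * (fp y - fp x)))
    (h₂ : Negl a b T (fun x y => fp x * (lm y - lm x) + lp x * (fm y - fm x))) :
    Negl a b T (fun x y => (fm y * lp y + lm y * fp y) - (fm x * lp x + lm x * fp x)) := by
  refine ((h₁.add h₂).add ((Negl.incr_mul_incr hlp hfm).add (Negl.incr_mul_incr hlm hfp))).congr
    fun x y _ _ _ => ?_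
  ring

lemma negl_ratio_iff (hlm : ContinuousOn lm (Icc a b)) (hlp : ContinuousOn lp (Icc a b))
    (hfm : ContinuousOn fm (Icc a b)) (hfp : ContinuousOn fp (Icc a b))
    (hM : ContinuousOn M (Icc a b)) (hPc : ContinuousOn P (Icc a b)) (hP : IncrLE a b T P)
    (hMlm : ∀ x ∈ Icc a b, M x * lm x = 1) (hPlp : ∀ x ∈ Icc a b, P x * lp x = 1)
    (hκ : ∀ x ∈ Icc a b, fm x * lp x + lm x * fp x = κ) :
    Negl a b T (fun x y => fm x * (lp y - lp x) + lm x * (fp y - fp x)) ↔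
      Negl a b T (fun x y => fp y * P y - fp x * P x - κ * (M x * (P y - P x))) := by
  have h1 := (Negl.incr_mul_incr hlp hP).mul_left (hfm.mul hM)
  have h2 := Negl.incr_mul_incr hfp hP
  have key : ∀ x y, a ≤ x → x ≤ y → y ≤ b →
      fp y * P y - fp x * P x - κ * (M x * (P y - P x)) =
        P x * M x * (fm x * (lp y - lp x) + lm x * (fp y - fp x)) +
          (fm x * M x * ((lp y - lp x) * (P y - P x)) + (fp y - fp x) * (P y - P x)) := by
    intro x y hx hxy hy
    have e1 := hMlm x ⟨hx, hxy.trans hy⟩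
    have e2 := hPlp x ⟨hx, hxy.trans hy⟩
    have e3 := hPlp y ⟨hx.trans hxy, hy⟩
    rw [← hκ x ⟨hx, hxy.trans hy⟩]
    linear_combination (-fp x * (P y - P x) - P x * (fp y - fp x)) * e1 -
      fm x * M x * (e3 - e2)
  constructor
  · intro h
    exact ((h.mul_left (hPc.mul hM)).add (h1.add h2)).congr key
  · intro h
    refine ((h.add ((h1.add h2).mul_left (f := fun _ => -1) continuousOn_const)).mul_left
      (hlp.mul hlm)).congr fun x y hx hxy hy => ?_
    simp only [Pi.mul_apply]
    rw [key x y hx hxy hy]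
    have e1 := hMlm x ⟨hx, hxy.trans hy⟩
    have e2 := hPlp x ⟨hx, hxy.trans hy⟩
    linear_combination -(fm x * (lp y - lp x) + lm x * (fp y - fp x)) * (e1 * (P x * lp x) + e2)

end Luckock

section Solutions

variable {a b κ : ℝ} {lm lp fm fp : ℝ → ℝ} {νip νim : SignedMeasure ℝ}

lemma A3.inv_continuousOn (hab : a < b) (hA3 : A3 a b lm lp) (hA6 : A6 a b lm lp) :
    (∀ x ∈ Icc a b, 0 < lm x) ∧ (∀ x ∈ Icc a b, 0 < lp x) ∧
      ContinuousOn (fun x => (lm x)⁻¹) (Icc a b) ∧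
      ContinuousOn (fun x => (lp x)⁻¹) (Icc a b) := by
  obtain ⟨hlm, hlp, hanti, hmono, -, -⟩ := hA3
  have h1 : ∀ x ∈ Icc a b, 0 < lm x := fun x hx =>
    hA6.2.trans_le (hanti hx (right_mem_Icc.2 hab.le) hx.2)
  have h2 : ∀ x ∈ Icc a b, 0 < lp x := fun x hx =>
    hA6.1.trans_le (hmono (left_mem_Icc.2 hab.le) hx hx.1)
  exact ⟨h1, h2, hlm.inv₀ fun x hx => (h1 x hx).ne', hlp.inv₀ fun x hx => (h2 x hx).ne'⟩

lemma sInt_inv_nonpos (hab : a < b) (hA3 : A3 a b lm lp) (hA6 : A6 a b lm lp)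
    (hνip : IsLS a b (fun x => (lp x)⁻¹) νip) :
    sInt νip (fun t => (lm t)⁻¹) (Ioc a b) ≤ 0 := by
  obtain ⟨hm, hp, hM, hP⟩ := hA3.inv_continuousOn hab hA6
  have hn := hνip.negl_sInt hP (μ := νip.totalVariation) le_rfl hM
  have := incr_nonpos_of_negl (f := fun x => sInt νip (fun t => (lm t)⁻¹) (Ioc a x))
    (R := fun x y => (lm x)⁻¹ * ((lp y)⁻¹ - (lp x)⁻¹))
    (hn.congr fun x y hx hxy _ => by rw [hνip.sInt_Ioc_sub hM hx hxy])
    (fun x y hx hxy hy => mul_nonpos_of_nonneg_of_nonpos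
      (inv_nonneg.2 (hm x ⟨hx, hxy.trans hy⟩).le)
      (sub_nonpos.2 (inv_anti₀ (hp x ⟨hx, hxy.trans hy⟩)
        (hA3.2.2.2.1 ⟨hx, hxy.trans hy⟩ ⟨hx.trans hxy, hy⟩ hxy))))
    le_rfl hab.le le_rfl
  simpa [sInt] using this

lemma LuckockSol.exists_eq (hab : a < b) (hA3 : A3 a b lm lp) (hA6 : A6 a b lm lp)
    (hνip : IsLS a b (fun x => (lp x)⁻¹) νip) (hνim : IsLS a b (fun x => (lm x)⁻¹) νim)
    (hsol : LuckockSol a b lm lp fm fp) :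
    ∃ κ : ℝ, fp b * (lp b)⁻¹ + fm b * (lm b)⁻¹ = κ * (lm b * lp b)⁻¹ ∧
      ∀ x ∈ Icc a b,
        fp x * (lp x)⁻¹ = (lp a)⁻¹ + κ * sInt νip (fun t => (lm t)⁻¹) (Ioc a x) ∧
        fm x * (lm x)⁻¹ = (lm b)⁻¹ - κ * sInt νim (fun t => (lp t)⁻¹) (Ioc x b) := by
  obtain ⟨hm, hp, hM, hP⟩ := hA3.inv_continuousOn hab hA6
  obtain ⟨hlm, hlp, hanti, hmono, -, -⟩ := hA3
  obtain ⟨hfm, hfp, hbm, hbp, hfmb, hfpa, heq⟩ := hsol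
  obtain ⟨νlm, hνlm⟩ := exists_isLS hab.le hlm (hanti.boundedVariationOn_Icc hab.le)
  obtain ⟨νlp, hνlp⟩ := exists_isLS hab.le hlp (hmono.boundedVariationOn_Icc hab.le)
  obtain ⟨νfm, hνfm⟩ := exists_isLS hab.le hfm hbm
  obtain ⟨νfp, hνfp⟩ := exists_isLS hab.le hfp hbp
  have heq' := heq νlm νlp νfm νfp hνlm hνlp hνfm hνfp
  obtain ⟨μ, hμ, hμlm, hμlp, hμfm, hμfp, hμip, hμim⟩ :=
    exists_measure_ge νlm νlp νfm νfp νip νim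
  have E₁ := (sInt_add_sInt_eq_zero_iff hab.le hνlp hνfp hlp hfp hfm hlm hμlp hμfp).1
    fun s hs => (heq' s hs).1
  have E₂ := (sInt_add_sInt_eq_zero_iff hab.le hνlm hνfm hlm hfm hfp hlp hμlm hμfm).1
    fun s hs => (heq' s hs).2
  have hcons := negl_conserved hlm hlp (hνfm.incrLE hfm hμfm) (hνfp.incrLE hfp hμfp) E₁ E₂
  have hκ : ∀ x ∈ Icc a b, fm x * lp x + lm x * fp x = fm b * lp b + lm b * fp b :=
    fun x hx => eq_of_negl_incr (f := fun x => fm x * lp x + lm x * fp x) hcons hx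
      (right_mem_Icc.2 hab.le)
  have hMlm : ∀ x ∈ Icc a b, (lm x)⁻¹ * lm x = 1 := fun x hx => inv_mul_cancel₀ (hm x hx).ne'
  have hPlp : ∀ x ∈ Icc a b, (lp x)⁻¹ * lp x = 1 := fun x hx => inv_mul_cancel₀ (hp x hx).ne'
  have D₁ := (negl_ratio_iff hlm hlp hfm hfp hM hP (hνip.incrLE hP hμip) hMlm hPlp hκ).1 E₁
  have D₂ := (negl_ratio_iff (κ := fm b * lp b + lm b * fp b) hlp hlm hfp hfm hP hM
    (hνim.incrLE hM hμim) hPlp hMlm fun x hx => by linear_combination hκ x hx).1 E₂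
  refine ⟨fm b * lp b + lm b * fp b, ?_, fun x hx => ⟨?_, ?_⟩⟩
  · have h1 := (hm b (right_mem_Icc.2 hab.le)).ne'
    have h2 := (hp b (right_mem_Icc.2 hab.le)).ne'
    field_simp
    ring
  · have := hνip.sub_eq_of_negl (u := fun x => fp x * (lp x)⁻¹) hP hμip hM D₁ le_rfl hx.1 hx.2
    rw [hfpa] at this
    linarith
  · have := hνim.sub_eq_of_negl (u := fun x => fm x * (lm x)⁻¹) hM hμim hP D₂ hx.1 hx.2 le_rfl
    rw [hfmb] at this ⊢
    linarith

lemma luckockSol_of_const (hab : a < b) (hA3 : A3 a b lm lp) (hA6 : A6 a b lm lp)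
    (hνip : IsLS a b (fun x => (lp x)⁻¹) νip) (hνim : IsLS a b (fun x => (lm x)⁻¹) νim)
    (hκ : (lp a)⁻¹ + κ * sInt νip (fun t => (lm t)⁻¹) (Ioc a b) + (lm b)⁻¹ =
      κ * (lm b * lp b)⁻¹) :
    LuckockSol a b lm lp
      (fun x => lm x * ((lm b)⁻¹ - κ * (sInt νim (fun t => (lp t)⁻¹) (Ioc a b) -
        sInt νim (fun t => (lp t)⁻¹) (Ioc a x))))
      (fun x => lp x * ((lp a)⁻¹ + κ * sInt νip (fun t => (lm t)⁻¹) (Ioc a x))) := by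
  obtain ⟨hm, hp, hM, hP⟩ := hA3.inv_continuousOn hab hA6
  obtain ⟨hlm, hlp, hanti, hmono, -, -⟩ := hA3
  have ha : a ∈ Icc a b := left_mem_Icc.2 hab.le
  have hb : b ∈ Icc a b := right_mem_Icc.2 hab.le
  have hF := hνip.continuousOn_sInt hP hM
  have hG := hνim.continuousOn_sInt hM hP
  set F : ℝ → ℝ := fun x => sInt νip (fun t => (lm t)⁻¹) (Ioc a x) with hFdef
  set G : ℝ → ℝ := fun x => sInt νim (fun t => (lp t)⁻¹) (Ioc a x) with hGdef
  have hFa : F a = 0 := by simp [hFdef, sInt]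
  change (lp a)⁻¹ + κ * F b + (lm b)⁻¹ = κ * (lm b * lp b)⁻¹ at hκ
  change LuckockSol a b lm lp (fun x => lm x * ((lm b)⁻¹ - κ * (G b - G x)))
    (fun x => lp x * ((lp a)⁻¹ + κ * F x))
  have hv : ∀ x, (lm b)⁻¹ - κ * (G b - G x) = ((lm b)⁻¹ - κ * G b) + κ * G x :=
    fun x => by ring
  simp_rw [hv]
  have hfp : ContinuousOn (fun x => lp x * ((lp a)⁻¹ + κ * F x)) (Icc a b) :=
    hlp.mul (continuousOn_const.add (continuousOn_const.mul hF))
  have hfm : ContinuousOn (fun x => lm x * (((lm b)⁻¹ - κ * G b) + κ * G x)) (Icc a b) :=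
    hlm.mul (continuousOn_const.add (continuousOn_const.mul hG))
  refine ⟨hfm, hfp, ?_, ?_, ?_, ?_, ?_⟩
  · exact (hanti.boundedVariationOn_Icc hab.le).mul
      (((hνim.incrLE_sInt le_rfl hP).const_add_mul _ κ).boundedVariationOn
        (boundedVariationOn_real_Ioc hab.le))
  · exact (hmono.boundedVariationOn_Icc hab.le).mul
      (((hνip.incrLE_sInt le_rfl hM).const_add_mul _ κ).boundedVariationOn
        (boundedVariationOn_real_Ioc hab.le))
  · have := (hm b hb).ne'
    change lm b * ((lm b)⁻¹ - κ * G b + κ * G b) = 1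
    rw [← hv]
    simp [this]
  · have := (hp a ha).ne'
    simp [this, hFa]
  intro νlm νlp νfm νfp hνlm hνlp hνfm hνfp
  obtain ⟨μ, hμ, hμlm, hμlp, hμfm, hμfp, hμip, hμim⟩ :=
    exists_measure_ge νlm νlp νfm νfp νip νim
  have D₁ : Negl a b (fun x => μ.real (Ioc a x)) (fun x y =>
      ((lp a)⁻¹ + κ * F y) - ((lp a)⁻¹ + κ * F x) -
        κ * ((lm x)⁻¹ * ((lp y)⁻¹ - (lp x)⁻¹))) := by
    refine ((hνip.negl_sInt hP hμip hM).mul_left (f := fun _ => κ) continuousOn_const).congr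
      fun x y hx hxy _ => ?_
    rw [← hνip.sInt_Ioc_sub hM hx hxy]
    ring
  have D₂ : Negl a b (fun x => μ.real (Ioc a x)) (fun x y =>
      (((lm b)⁻¹ - κ * G b) + κ * G y) - (((lm b)⁻¹ - κ * G b) + κ * G x) -
        κ * ((lp x)⁻¹ * ((lm y)⁻¹ - (lm x)⁻¹))) := by
    refine ((hνim.negl_sInt hM hμim hP).mul_left (f := fun _ => κ) continuousOn_const).congr
      fun x y hx hxy _ => ?_
    rw [← hνim.sInt_Ioc_sub hP hx hxy]
    ring
  have hIP := hνip.incrLE hP hμip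
  have hIM := hνim.incrLE hM hμim
  have hsum : ∀ x ∈ Icc a b,
      ((lp a)⁻¹ + κ * F x) + (((lm b)⁻¹ - κ * G b) + κ * G x) = κ * ((lm x)⁻¹ * (lp x)⁻¹) := by
    have hn : Negl a b (fun x => μ.real (Ioc a x)) (fun x y =>
        (((lp a)⁻¹ + κ * F y) + (((lm b)⁻¹ - κ * G b) + κ * G y) - κ * ((lm y)⁻¹ * (lp y)⁻¹)) -
        (((lp a)⁻¹ + κ * F x) + (((lm b)⁻¹ - κ * G b) + κ * G x) -
          κ * ((lm x)⁻¹ * (lp x)⁻¹))) := by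
      refine ((D₁.add D₂).add ((Negl.incr_mul_incr hM hIP).mul_left (f := fun _ => -κ)
        continuousOn_const)).congr fun x y _ _ _ => ?_
      ring
    intro x hx
    have := eq_of_negl_incr (f := fun x => ((lp a)⁻¹ + κ * F x) +
      (((lm b)⁻¹ - κ * G b) + κ * G x) - κ * ((lm x)⁻¹ * (lp x)⁻¹)) hn hx hb
    rw [mul_inv] at hκ
    linarith
  have hcons : ∀ x ∈ Icc a b, lm x * (((lm b)⁻¹ - κ * G b) + κ * G x) * lp x +
      lm x * (lp x * ((lp a)⁻¹ + κ * F x)) = κ := by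
    intro x hx
    have h1 := (hm x hx).ne'
    have h2 := (hp x hx).ne'
    calc _ = lm x * lp x *
        (((lp a)⁻¹ + κ * F x) + (((lm b)⁻¹ - κ * G b) + κ * G x)) := by ring
      _ = κ := by rw [hsum x hx]; field_simp
  have hMlm : ∀ x ∈ Icc a b, (lm x)⁻¹ * lm x = 1 := fun x hx => inv_mul_cancel₀ (hm x hx).ne'
  have hPlp : ∀ x ∈ Icc a b, (lp x)⁻¹ * lp x = 1 := fun x hx => inv_mul_cancel₀ (hp x hx).ne'
  have E₁ := (negl_ratio_iff hlm hlp hfm hfp hM hP hIP hMlm hPlp hcons).2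
    (D₁.congr fun x y hx hxy hy => by
      linear_combination ((lp a)⁻¹ + κ * F y) * hPlp y ⟨hx.trans hxy, hy⟩ -
        ((lp a)⁻¹ + κ * F x) * hPlp x ⟨hx, hxy.trans hy⟩)
  have E₂ := (negl_ratio_iff (κ := κ) hlp hlm hfp hfm hP hM hIM hPlp hMlm
    fun x hx => by linear_combination hcons x hx).2
    (D₂.congr fun x y hx hxy hy => by
      linear_combination (((lm b)⁻¹ - κ * G b) + κ * G y) * hMlm y ⟨hx.trans hxy, hy⟩ -
        (((lm b)⁻¹ - κ * G b) + κ * G x) * hMlm x ⟨hx, hxy.trans hy⟩)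
  intro s hs
  exact ⟨(sInt_add_sInt_eq_zero_iff hab.le hνlp hνfp hlp hfp hfm hlm hμlp hμfp).2 E₁ s hs,
    (sInt_add_sInt_eq_zero_iff hab.le hνlm hνfm hlm hfm hfp hlp hμlm hμfm).2 E₂ s hs⟩

end Solutions

/-- under (A3) and (A6), Luckock's equation has exactly one solution
`(fm, fp)` (unique as functions on `[a,b]`), and it is given by the explicit formulas
`fp x / lp x = 1/lp a + κ_L ∫_{(a,x]} (1/lm) d(1/lp)` and
`fm x / lm x = 1/lm b − κ_L ∫_{(x,b]} (1/lp) d(1/lm)`, where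
`κ_L = Γ⁻¹ (1/lm b + 1/lp a)`.  Here `νip` and `νim` are the Lebesgue-Stieltjes
measures of `1/λ₊` and `1/λ₋` on `[a,b]`. -/
theorem stmt1 (a b : ℝ) (hab : a < b) (lm lp : ℝ → ℝ)
    (hA3 : A3 a b lm lp) (hA6 : A6 a b lm lp)
    (νip νim : MeasureTheory.SignedMeasure ℝ)
    (hνip : IsLS a b (fun x => (lp x)⁻¹) νip)
    (hνim : IsLS a b (fun x => (lm x)⁻¹) νim) :
    ∃ fm fp : ℝ → ℝ, LuckockSol a b lm lp fm fp ∧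
      (∀ fm' fp' : ℝ → ℝ, LuckockSol a b lm lp fm' fp' →
        Set.EqOn fm' fm (Set.Icc a b) ∧ Set.EqOn fp' fp (Set.Icc a b)) ∧
      ∀ x ∈ Set.Icc a b,
        fp x / lp x = (lp a)⁻¹ +
          ((lm b * lp b)⁻¹ - sInt νip (fun t => (lm t)⁻¹) (Set.Icc a b))⁻¹ *
            ((lm b)⁻¹ + (lp a)⁻¹) * sInt νip (fun t => (lm t)⁻¹) (Set.Ioc a x) ∧
        fm x / lm x = (lm b)⁻¹ -
          ((lm b * lp b)⁻¹ - sInt νip (fun t => (lm t)⁻¹) (Set.Icc a b))⁻¹ *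
            ((lm b)⁻¹ + (lp a)⁻¹) * sInt νim (fun t => (lp t)⁻¹) (Set.Ioc x b) := by
  obtain ⟨hm, hp, hM, hP⟩ := hA3.inv_continuousOn hab hA6
  have hb : b ∈ Icc a b := right_mem_Icc.2 hab.le
  have hIcc : sInt νip (fun t => (lm t)⁻¹) (Icc a b) =
      sInt νip (fun t => (lm t)⁻¹) (Ioc a b) := by
    have := hνip.nullSingletonClass_totalVariation hP
    rw [← Ioc_union_left hab.le, sInt_union (hνip.integrable hM) (by simp)
      (measurableSet_singleton a), sInt_eq_zero (s := {a}) (measure_singleton a), add_zero]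
  rw [hIcc]
  have hneg := sInt_inv_nonpos hab hA3 hA6 hνip
  set J := sInt νip (fun t => (lm t)⁻¹) (Ioc a b) with hJ
  have hΓ : 0 < (lm b * lp b)⁻¹ - J := by
    have : 0 < (lm b * lp b)⁻¹ := inv_pos.2 (mul_pos (hm b hb) (hp b hb))
    linarith
  set κ := ((lm b * lp b)⁻¹ - J)⁻¹ * ((lm b)⁻¹ + (lp a)⁻¹) with hκ
  have hκΓ : κ * ((lm b * lp b)⁻¹ - J) = (lm b)⁻¹ + (lp a)⁻¹ := by
    rw [hκ, mul_comm, mul_inv_cancel_left₀ hΓ.ne']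
  have hsol := luckockSol_of_const (κ := κ) hab hA3 hA6 hνip hνim (by
    rw [← hJ]
    linarith)
  have hform : ∀ fm fp : ℝ → ℝ, LuckockSol a b lm lp fm fp → ∀ x ∈ Icc a b,
      fp x / lp x = (lp a)⁻¹ + κ * sInt νip (fun t => (lm t)⁻¹) (Ioc a x) ∧
      fm x / lm x = (lm b)⁻¹ - κ * sInt νim (fun t => (lp t)⁻¹) (Ioc x b) := by
    intro fm fp h
    obtain ⟨κ', hκ', hx⟩ := h.exists_eq hab hA3 hA6 hνip hνim
    have : κ' = κ := by
      rw [(hx b hb).1, (hx b hb).2, ← hJ, Ioc_self,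
        show sInt νim (fun t => (lp t)⁻¹) ∅ = 0 by simp [sInt]] at hκ'
      refine mul_right_cancel₀ hΓ.ne' ?_
      rw [hκΓ]
      linarith
    simpa only [div_eq_mul_inv, this] using hx
  refine ⟨_, _, hsol, fun fm' fp' h => ⟨fun x hx => ?_, fun x hx => ?_⟩, hform _ _ hsol⟩
  · exact (div_left_inj' (hm x hx).ne').1
      ((hform _ _ h x hx).2.trans (hform _ _ hsol x hx).2.symm)
  · exact (div_left_inj' (hp x hx).ne').1
      ((hform _ _ h x hx).1.trans (hform _ _ hsol x hx).1.symm)
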